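/- For every d>0 and δ>0 there exists E>0 such that for all r>d, all h>0, and all z∈ℂ with Re z<−E one has |∫₀^∞ e^{zt} p_h(r,t) dt| ≤ ((1+δ)/(2π)) · (π²/(4·(−Re z)·r²))^{1/4} · exp(−√(−Re z)·r), and the same bound holds with p_h replaced by the free kernel p_0. (This is an upper bound for the modulus of the Green function of the Landau Hamiltonian at distance r.) -/

import Mathlib

open MeasureTheory Real Set

/-- Modulus of the Landau heat kernel at distance `r`. -/
noncomputable def landauHeatKernel (h r t : ℝ) : ℝ :=
  h / (4 * π * Real.sinh (h * t)) *
    Real.exp (-(h * r ^ 2 * (Real.cosh (h * t) / Real.sinh (h * t))) / 4)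

/-- Free heat kernel on `ℝ²` at distance `r`. -/
noncomputable def freeHeatKernel (r t : ℝ) : ℝ :=
  1 / (4 * π * t) * Real.exp (-(r ^ 2) / (4 * t))

theorem Real.one_add_sq_div_two_le_cosh (u : ℝ) : 1 + u ^ 2 / 2 ≤ Real.cosh u := by
  have h1 : Real.cosh u = 1 + 2 * Real.sinh (u / 2) ^ 2 := by
    have h := Real.cosh_two_mul (u / 2)
    rw [Real.cosh_sq, mul_div_cancel₀ u two_ne_zero] at h
    linarith
  have h2 : (u / 2) ^ 2 ≤ Real.sinh (u / 2) ^ 2 := by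
    rcases le_total 0 (u / 2) with h | h
    · exact pow_le_pow_left₀ h (Real.self_le_sinh_iff.2 h) 2
    · have := Real.sinh_le_self_iff.2 h
      nlinarith
  linarith

theorem Real.sinh_le_self_mul_cosh {x : ℝ} (hx : 0 ≤ x) : Real.sinh x ≤ x * Real.cosh x := by
  refine hasSum_le (fun n => ?_) (Real.hasSum_sinh x) ((Real.hasSum_cosh x).mul_left x)
  rw [← mul_div_assoc, ← pow_succ']
  gcongr
  omega

theorem landauHeatKernel_nonneg {h t : ℝ} (r : ℝ) (hh : 0 < h) (ht : 0 < t) :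
    0 ≤ landauHeatKernel h r t := by
  have := Real.sinh_pos_iff.2 (mul_pos hh ht)
  unfold landauHeatKernel
  positivity

theorem freeHeatKernel_nonneg {t : ℝ} (r : ℝ) (ht : 0 < t) : 0 ≤ freeHeatKernel r t := by
  unfold freeHeatKernel
  positivity

/-- Diamagnetic inequality for the heat kernels. -/
theorem landauHeatKernel_le_freeHeatKernel {h t : ℝ} (r : ℝ) (hh : 0 < h) (ht : 0 < t) :
    landauHeatKernel h r t ≤ freeHeatKernel r t := by
  have hht := mul_pos hh ht
  have hs := Real.sinh_pos_iff.2 hht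
  have h1 := Real.self_le_sinh_iff.2 hht.le
  have h2 := Real.sinh_le_self_mul_cosh hht.le
  unfold landauHeatKernel freeHeatKernel
  refine mul_le_mul ?_ (Real.exp_le_exp.2 ?_) (Real.exp_pos _).le (by positivity)
  · rw [div_le_div_iff₀ (by positivity) (by positivity)]
    nlinarith [mul_le_mul_of_nonneg_left h1 (by positivity : 0 ≤ 4 * π)]
  · have h3 : 1 / t ≤ h * (Real.cosh (h * t) / Real.sinh (h * t)) := by
      rw [← mul_div_assoc, div_le_div_iff₀ ht hs]
      linarith
    have h4 : -(r ^ 2) / (4 * t) = -(r ^ 2 * (1 / t)) / 4 := by field_simp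
    rw [h4]
    nlinarith [mul_le_mul_of_nonneg_left h3 (sq_nonneg r)]

theorem integrable_exp_neg_mul_cosh {x : ℝ} (hx : 0 < x) :
    Integrable fun u : ℝ => Real.exp (-x * Real.cosh u) := by
  refine (integrable_exp_neg_mul_sq (half_pos hx)).mono'
    (by fun_prop) (Filter.Eventually.of_forall fun u => ?_)
  rw [Real.norm_of_nonneg (Real.exp_pos _).le]
  refine Real.exp_le_exp.2 ?_
  nlinarith [mul_le_mul_of_nonneg_left (Real.one_add_sq_div_two_le_cosh u) hx.le]

theorem integral_exp_neg_mul_cosh_le {x : ℝ} (hx : 0 < x) :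
    ∫ u : ℝ, Real.exp (-x * Real.cosh u) ≤ Real.exp (-x) * √(2 * π / x) := by
  have h : √(2 * π / x) = ∫ u : ℝ, Real.exp (-(x / 2) * u ^ 2) := by
    rw [integral_gaussian]
    congr 1
    field_simp
  rw [h, ← integral_const_mul]
  refine integral_mono (integrable_exp_neg_mul_cosh hx)
    ((integrable_exp_neg_mul_sq (half_pos hx)).const_mul _) fun u => ?_
  simp only [← Real.exp_add]
  refine Real.exp_le_exp.2 ?_
  nlinarith [mul_le_mul_of_nonneg_left (Real.one_add_sq_div_two_le_cosh u) hx.le]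

theorem image_const_mul_exp_univ {a : ℝ} (ha : 0 < a) :
    (fun u => a * Real.exp u) '' univ = Ioi 0 := by
  rw [image_univ]
  ext t
  refine ⟨?_, fun ht => ⟨Real.log (t / a), ?_⟩⟩
  · rintro ⟨u, rfl⟩
    exact mul_pos ha (Real.exp_pos u)
  · simp only
    rw [Real.exp_log (div_pos ht ha), mul_div_cancel₀ _ ha.ne']

theorem injective_const_mul_exp {a : ℝ} (ha : 0 < a) :
    Function.Injective fun u => a * Real.exp u :=
  fun _ _ h => Real.exp_injective (mul_left_cancel₀ ha.ne' h)

theorem abs_smul_exp_mul_freeHeatKernel {r s : ℝ} (hr : 0 < r) (hs : 0 < s) (u : ℝ) :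
    |r / (2 * s) * Real.exp u| • (Real.exp (-s ^ 2 * (r / (2 * s) * Real.exp u)) *
      freeHeatKernel r (r / (2 * s) * Real.exp u)) =
      1 / (4 * π) * Real.exp (-(s * r) * Real.cosh u) := by
  have he := Real.exp_pos u
  have h : Real.exp (-(s * r) * Real.cosh u) = Real.exp (-s ^ 2 * (r / (2 * s) * Real.exp u)) *
      Real.exp (-(r ^ 2) / (4 * (r / (2 * s) * Real.exp u))) := by
    rw [← Real.exp_add, Real.cosh_eq, Real.exp_neg]
    congr 1
    field_simp
    ring
  rw [abs_of_pos (by positivity), smul_eq_mul, freeHeatKernel, h]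
  field_simp

theorem integrableOn_exp_mul_freeHeatKernel {r s : ℝ} (hr : 0 < r) (hs : 0 < s) :
    IntegrableOn (fun t => Real.exp (-s ^ 2 * t) * freeHeatKernel r t) (Ioi 0) := by
  have ha : 0 < r / (2 * s) := by positivity
  rw [← image_const_mul_exp_univ ha, integrableOn_image_iff_integrableOn_abs_deriv_smul
    MeasurableSet.univ
    (fun u _ => ((Real.hasDerivAt_exp u).const_mul (r / (2 * s))).hasDerivWithinAt)
    (injective_const_mul_exp ha).injOn]
  simp only [abs_smul_exp_mul_freeHeatKernel hr hs, integrableOn_univ]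
  exact (integrable_exp_neg_mul_cosh (mul_pos hs hr)).const_mul _

theorem integral_exp_mul_freeHeatKernel {r s : ℝ} (hr : 0 < r) (hs : 0 < s) :
    ∫ t in Ioi 0, Real.exp (-s ^ 2 * t) * freeHeatKernel r t =
      1 / (4 * π) * ∫ u : ℝ, Real.exp (-(s * r) * Real.cosh u) := by
  have ha : 0 < r / (2 * s) := by positivity
  rw [← image_const_mul_exp_univ ha, integral_image_eq_integral_abs_deriv_smul
    MeasurableSet.univ
    (fun u _ => ((Real.hasDerivAt_exp u).const_mul (r / (2 * s))).hasDerivWithinAt)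
    (injective_const_mul_exp ha).injOn]
  simp only [abs_smul_exp_mul_freeHeatKernel hr hs, setIntegral_univ, integral_const_mul]

theorem integral_exp_mul_freeHeatKernel_le {r s : ℝ} (hr : 0 < r) (hs : 0 < s) :
    ∫ t in Ioi 0, Real.exp (-s ^ 2 * t) * freeHeatKernel r t ≤
      1 / (2 * π) * (π ^ 2 / (4 * s ^ 2 * r ^ 2)) ^ ((1 : ℝ) / 4) * Real.exp (-s * r) := by
  have hsr := mul_pos hs hr
  have h1 : (π ^ 2 / (4 * s ^ 2 * r ^ 2)) ^ ((1 : ℝ) / 4) = √(π / (2 * (s * r))) := by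
    have : π ^ 2 / (4 * s ^ 2 * r ^ 2) = (π / (2 * (s * r))) ^ (2 : ℝ) := by
      rw [Real.rpow_two]
      field_simp
      norm_num
    rw [this, ← Real.rpow_mul (by positivity), Real.sqrt_eq_rpow]
    norm_num
  have h2 : √(2 * π / (s * r)) = 2 * √(π / (2 * (s * r))) := by
    have : 2 * π / (s * r) = 2 ^ 2 * (π / (2 * (s * r))) := by
      field_simp
    rw [this, Real.sqrt_mul (by positivity), Real.sqrt_sq zero_le_two]
  rw [integral_exp_mul_freeHeatKernel hr hs, h1]
  calc 1 / (4 * π) * ∫ u : ℝ, Real.exp (-(s * r) * Real.cosh u)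
      ≤ 1 / (4 * π) * (Real.exp (-(s * r)) * √(2 * π / (s * r))) := by
        gcongr
        exact integral_exp_neg_mul_cosh_le hsr
    _ = 1 / (2 * π) * √(π / (2 * (s * r))) * Real.exp (-s * r) := by
        rw [h2, neg_mul]
        field_simp
        norm_num

theorem norm_integral_cexp_mul_le {r : ℝ} {z : ℂ} (hr : 0 < r) (hz : z.re < 0) {p : ℝ → ℝ}
    (hp : ∀ t, 0 < t → 0 ≤ p t) (hpf : ∀ t, 0 < t → p t ≤ freeHeatKernel r t) :
    ‖∫ t in Ioi (0 : ℝ), Complex.exp (z * t) * ((p t : ℝ) : ℂ)‖ ≤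
      1 / (2 * π) * (π ^ 2 / (4 * (-z.re) * r ^ 2)) ^ ((1 : ℝ) / 4) *
        Real.exp (-Real.sqrt (-z.re) * r) := by
  have hs : 0 < √(-z.re) := Real.sqrt_pos.2 (neg_pos.2 hz)
  have hsq : √(-z.re) ^ 2 = -z.re := Real.sq_sqrt (neg_pos.2 hz).le
  have hle := integral_exp_mul_freeHeatKernel_le hr hs
  have hint := integrableOn_exp_mul_freeHeatKernel hr hs
  simp only [hsq, neg_neg] at hle hint
  refine (norm_integral_le_of_norm_le hint ?_).trans hle
  filter_upwards [ae_restrict_mem measurableSet_Ioi] with t ht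
  rw [norm_mul, Complex.norm_exp, Complex.norm_real, Real.norm_of_nonneg (hp t ht),
    Complex.re_mul_ofReal]
  gcongr
  exact hpf t ht

/-- Upper bound for the Green function of the Landau Hamiltonian (and of the free
Laplacian): for all `d,δ>0` there is `E>0` such that for `r>d`, `h>0`, `Re z<−E`,
`|∫₀^∞ e^{zt} p_h(r,t) dt| ≤ ((1+δ)/(2π)) (π²/(4(−Re z) r²))^{1/4} e^{−√(−Re z) r}`,
and the same bound with `p_h` replaced by `p_0`. -/
theorem landau_green_upper_bound (d δ : ℝ) (hd : 0 < d) (hδ : 0 < δ) :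
    ∃ E > 0, ∀ (r h : ℝ) (z : ℂ), d < r → 0 < h → z.re < -E →
      (‖∫ t in Ioi (0 : ℝ), Complex.exp (z * t) * ((landauHeatKernel h r t : ℝ) : ℂ)‖ ≤
        ((1 + δ) / (2 * π)) * (π ^ 2 / (4 * (-z.re) * r ^ 2)) ^ ((1 : ℝ) / 4) *
          Real.exp (-Real.sqrt (-z.re) * r)) ∧
      (‖∫ t in Ioi (0 : ℝ), Complex.exp (z * t) * ((freeHeatKernel r t : ℝ) : ℂ)‖ ≤
        ((1 + δ) / (2 * π)) * (π ^ 2 / (4 * (-z.re) * r ^ 2)) ^ ((1 : ℝ) / 4) *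
          Real.exp (-Real.sqrt (-z.re) * r)) := by
  refine ⟨1, one_pos, fun r h z hr hh hz => ?_⟩
  have hr0 : 0 < r := hd.trans hr
  have hz0 : z.re < 0 := by linarith
  have hδ1 : 1 / (2 * π) * (π ^ 2 / (4 * (-z.re) * r ^ 2)) ^ ((1 : ℝ) / 4) *
        Real.exp (-Real.sqrt (-z.re) * r) ≤
      (1 + δ) / (2 * π) * (π ^ 2 / (4 * (-z.re) * r ^ 2)) ^ ((1 : ℝ) / 4) *
        Real.exp (-Real.sqrt (-z.re) * r) := by
    have : 0 < -z.re := neg_pos.2 hz0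
    gcongr
    linarith
  exact ⟨(norm_integral_cexp_mul_le hr0 hz0 (fun t => landauHeatKernel_nonneg r hh)
      fun t => landauHeatKernel_le_freeHeatKernel r hh).trans hδ1,
    (norm_integral_cexp_mul_le hr0 hz0 (fun t => freeHeatKernel_nonneg r)
      fun t _ => le_rfl).trans hδ1⟩
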